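/- arXiv:2605.15960 — 2 statements merged into one kernel-verified Lean document; each statement's English description precedes it below -/
import Mathlib

section
/- Reward hacking on open policy sets (Theorem 1 of Skalse et al., recovered as a corollary): fix a finite environment (S, A, T, d0, γ) with γ ∈ [0,1) and let Π be a set of stationary policies containing a nonempty subset open in Π^+. If R and R' are reward functions such that neither J_R nor J_{R'} is constant on Π, and J_R, J_{R'} do not induce the same ordering on Π, then (R, R') is hackable on Π: there exist π, π' ∈ Π with J_R(π) > J_R(π') and J_{R'}(π') > J_{R'}(π). -/
open Matrix

/-- `p` is a probability distribution on the finite set `S`. -/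
def IsDist {S : Type*} [Fintype S] (p : S → ℝ) : Prop :=
  (∀ s, 0 ≤ p s) ∧ ∑ s, p s = 1

/-- `π` is a stationary policy: each `π s` is a distribution over actions. -/
def IsPolicy {S A : Type*} [Fintype A] (π : S → A → ℝ) : Prop :=
  ∀ s, (∀ a, 0 ≤ π s a) ∧ ∑ a, π s a = 1

/-- `T` is a transition model: each `T s a` is a distribution over next states. -/
def IsTransModel {S A : Type*} [Fintype S] (T : S → A → S → ℝ) : Prop :=
  ∀ s a, (∀ s', 0 ≤ T s a s') ∧ ∑ s', T s a s' = 1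

/-- The policy-induced transition matrix `P^π(s,s') = Σ_a π(a|s) T(s'|s,a)`. -/
noncomputable def Pmat {S A : Type*} [Fintype A] (T : S → A → S → ℝ)
    (π : S → A → ℝ) : Matrix S S ℝ :=
  Matrix.of fun s s' => ∑ a, π s a * T s a s'

/-- The policy-induced expected reward vector `r^π(s) = Σ_a π(a|s) R(s,a)`. -/
noncomputable def rvec {S A : Type*} [Fintype A] (R : S → A → ℝ)
    (π : S → A → ℝ) : S → ℝ :=
  fun s => ∑ a, π s a * R s a

/-- The policy value `J(π) = Σ_s d0(s) V^π(s)` with `V^π = (I - γ P^π)⁻¹ r^π`. -/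
noncomputable def Jval {S A : Type*} [Fintype S] [Fintype A] [DecidableEq S]
    (T : S → A → S → ℝ) (R : S → A → ℝ) (d0 : S → ℝ) (γ : ℝ)
    (π : S → A → ℝ) : ℝ :=
  ∑ s, d0 s * (((1 : Matrix S S ℝ) - γ • Pmat T π)⁻¹ *ᵥ rvec R π) s

/-- Discounted visit counts `F^π(s,a) = μ^π(s) π(a|s)` with
`μ^π = (I - γ (P^π)ᵀ)⁻¹ d0`. -/
noncomputable def visitCount {S A : Type*} [Fintype S] [Fintype A] [DecidableEq S]
    (T : S → A → S → ℝ) (d0 : S → ℝ) (γ : ℝ) (π : S → A → ℝ) :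
    S → A → ℝ :=
  fun s a => ((((1 : Matrix S S ℝ) - γ • (Pmat T π)ᵀ)⁻¹) *ᵥ d0) s * π s a

/-- The policy value written as the inner product `J(π) = ⟨R, F^π⟩`. -/
noncomputable def JvisF {S A : Type*} [Fintype S] [Fintype A] [DecidableEq S]
    (T : S → A → S → ℝ) (R : S → A → ℝ) (d0 : S → ℝ) (γ : ℝ)
    (π : S → A → ℝ) : ℝ :=
  ∑ s, ∑ a, R s a * visitCount T d0 γ π s a

/-- The interior `Π⁺` of the policy space: policies with all entries positive. -/
def PiPlus {S A : Type*} [Fintype A] : Set (S → A → ℝ) :=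
  {π | IsPolicy π ∧ ∀ s a, 0 < π s a}

section FlowMixtures

open scoped Topology

variable {S A : Type*}

open Classical in
/-- The policy whose visit counts are the `t`-mixture of those of `π` (with state occupancy `μ`)
and those of `π'` (with state occupancy `ν`). -/
noncomputable def mixPolicy (π π' : S → A → ℝ) (μ ν : S → ℝ) (t : ℝ) : S → A → ℝ :=
  fun s a => if μ s = 0 then π s a else
    ((1 - t) * (μ s * π s a) + t * (ν s * π' s a)) / ((1 - t) * μ s + t * ν s)

lemma mixPolicy_mem_PiPlus [Fintype A] {π π' : S → A → ℝ} (hπ : π ∈ PiPlus) (hπ' : IsPolicy π')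
    {μ ν : S → ℝ} (hμ0 : ∀ s, 0 ≤ μ s) (hν0 : ∀ s, 0 ≤ ν s) {t : ℝ} (ht0 : 0 ≤ t) (ht1 : t < 1) :
    mixPolicy π π' μ ν t ∈ PiPlus := by
  have hpos : ∀ s a, 0 < mixPolicy π π' μ ν t s a := by
    intro s a
    unfold mixPolicy
    split_ifs with h
    · exact hπ.2 s a
    · have hμ : 0 < μ s := lt_of_le_of_ne (hμ0 s) (Ne.symm h)
      have h1 : 0 < 1 - t := by linarith
      have h2 := hπ.2 s a
      have h3 := hν0 s
      have h4 := (hπ' s).1 a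
      positivity
  refine ⟨fun s => ⟨fun a => (hpos s a).le, ?_⟩, hpos⟩
  unfold mixPolicy
  split_ifs with h
  · exact (hπ.1 s).2
  · have hμ : 0 < μ s := lt_of_le_of_ne (hμ0 s) (Ne.symm h)
    have h1 : 0 < 1 - t := by linarith
    have h3 := hν0 s
    have hD : (1 - t) * μ s + t * ν s ≠ 0 := by positivity
    rw [← Finset.sum_div, Finset.sum_add_distrib, ← Finset.mul_sum, ← Finset.mul_sum,
      ← Finset.mul_sum, ← Finset.mul_sum, (hπ.1 s).2, (hπ' s).2, mul_one, mul_one, div_self hD]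

lemma continuousAt_mixPolicy (π π' : S → A → ℝ) (μ ν : S → ℝ) :
    ContinuousAt (mixPolicy π π' μ ν) 0 := by
  refine continuousAt_pi.2 fun s => continuousAt_pi.2 fun a => ?_
  unfold mixPolicy
  split_ifs with h
  · exact continuousAt_const
  · refine ContinuousAt.div (by fun_prop) (by fun_prop) ?_
    simpa using h

lemma mixPolicy_zero (π π' : S → A → ℝ) (μ ν : S → ℝ) : mixPolicy π π' μ ν 0 = π := by
  ext s a
  unfold mixPolicy
  split_ifs with h
  · rfl
  · simp [h]

lemma mul_mixPolicy {π π' : S → A → ℝ} {μ ν : S → ℝ} (hμ0 : ∀ s, 0 ≤ μ s) (hν0 : ∀ s, 0 ≤ ν s)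
    (hsupp : ∀ s, μ s = 0 → ν s = 0) {t : ℝ} (ht0 : 0 ≤ t) (ht1 : t < 1) (s : S) (a : A) :
    ((1 - t) * μ s + t * ν s) * mixPolicy π π' μ ν t s a
      = (1 - t) * (μ s * π s a) + t * (ν s * π' s a) := by
  unfold mixPolicy
  split_ifs with h
  · simp [h, hsupp s h]
  · have hμ : 0 < μ s := lt_of_le_of_ne (hμ0 s) (Ne.symm h)
    have h1 : 0 < 1 - t := by linarith
    have h3 := hν0 s
    exact mul_div_cancel₀ _ (by positivity)

variable [Fintype S] [Fintype A]

lemma Pmat_nonneg {T : S → A → S → ℝ} (hT : IsTransModel T) {π : S → A → ℝ}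
    (hπ : IsPolicy π) (s s' : S) : 0 ≤ Pmat T π s s' :=
  Finset.sum_nonneg fun a _ => mul_nonneg ((hπ s).1 a) ((hT s a).1 s')

lemma sum_Pmat {T : S → A → S → ℝ} (hT : IsTransModel T) {π : S → A → ℝ}
    (hπ : IsPolicy π) (s : S) : ∑ s', Pmat T π s s' = 1 := by
  simp only [Pmat, Matrix.of_apply]
  rw [Finset.sum_comm]
  simp [← Finset.mul_sum, (hT s _).2, (hπ s).2]

/-- The state occupancy `ν` of the policy `π` solves the Bellman flow equation. -/
def IsFlow (T : S → A → S → ℝ) (d0 : S → ℝ) (γ : ℝ) (π : S → A → ℝ) (ν : S → ℝ) : Prop :=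
  ∀ s', ν s' = d0 s' + γ * ∑ s, ν s * Pmat T π s s'

lemma isUnit_det_one_sub_smul_Pmat [DecidableEq S] {T : S → A → S → ℝ} (hT : IsTransModel T)
    {γ : ℝ} (hγ0 : 0 ≤ γ) (hγ1 : γ < 1) {π : S → A → ℝ} (hπ : IsPolicy π) :
    IsUnit ((1 : Matrix S S ℝ) - γ • Pmat T π).det := by
  refine isUnit_iff_ne_zero.2 (det_ne_zero_of_sum_row_lt_diag fun s => ?_)
  have hsum := sum_Pmat hT hπ s
  rw [← Finset.add_sum_erase _ _ (Finset.mem_univ s)] at hsum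
  have hle : Pmat T π s s ≤ 1 := by
    linarith [Finset.sum_nonneg fun j (_ : j ∈ Finset.univ.erase s) => Pmat_nonneg hT hπ s j]
  have hoff : ∑ j ∈ Finset.univ.erase s, ‖((1 : Matrix S S ℝ) - γ • Pmat T π) s j‖
      = γ * ∑ j ∈ Finset.univ.erase s, Pmat T π s j := by
    rw [Finset.mul_sum]
    refine Finset.sum_congr rfl fun j hj => ?_
    have hne : s ≠ j := (Finset.ne_of_mem_erase hj).symm
    simp [Matrix.one_apply_ne hne, abs_of_nonneg hγ0, abs_of_nonneg (Pmat_nonneg hT hπ s j)]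
  rw [hoff, Matrix.sub_apply, Matrix.one_apply_eq, Matrix.smul_apply, smul_eq_mul, Real.norm_eq_abs]
  refine lt_of_lt_of_le ?_ (le_abs_self _)
  nlinarith

lemma Jval_eq_of_isFlow [DecidableEq S] {T : S → A → S → ℝ} (hT : IsTransModel T)
    {d0 : S → ℝ} {γ : ℝ} (hγ0 : 0 ≤ γ) (hγ1 : γ < 1) {π : S → A → ℝ} (hπ : IsPolicy π)
    {ν : S → ℝ} (hν : IsFlow T d0 γ π ν) (R : S → A → ℝ) :
    Jval T R d0 γ π = ∑ s, ∑ a, ν s * π s a * R s a := by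
  set M := (1 : Matrix S S ℝ) - γ • Pmat T π with hM
  have hd : d0 = ν ᵥ* M := by
    ext s'
    rw [hM, Matrix.vecMul_sub, Matrix.vecMul_one, Matrix.vecMul_smul]
    have := hν s'
    simp only [Pi.sub_apply, Pi.smul_apply, smul_eq_mul, Matrix.vecMul, dotProduct]
    linarith
  change d0 ⬝ᵥ (M⁻¹ *ᵥ rvec R π) = _
  rw [hd, ← Matrix.dotProduct_mulVec, Matrix.mulVec_mulVec,
    Matrix.mul_nonsing_inv _ (isUnit_det_one_sub_smul_Pmat hT hγ0 hγ1 hπ), Matrix.one_mulVec]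
  simp [dotProduct, rvec, Finset.mul_sum, mul_assoc]

/-- A nonnegative vector `n` with `n ≤ γ Pᵀ n` vanishes. -/
lemma eq_zero_of_le_discounted {T : S → A → S → ℝ} (hT : IsTransModel T)
    {γ : ℝ} (hγ1 : γ < 1) {π : S → A → ℝ} (hπ : IsPolicy π) {n : S → ℝ}
    (hn : ∀ s, 0 ≤ n s) (hle : ∀ s', n s' ≤ γ * ∑ s, n s * Pmat T π s s') (s : S) : n s = 0 := by
  have hsum : ∑ s', n s' ≤ γ * ∑ s, n s := by
    calc ∑ s', n s' ≤ ∑ s', γ * ∑ s, n s * Pmat T π s s' := Finset.sum_le_sum fun s' _ => hle s'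
      _ = γ * ∑ s, n s := by
        rw [← Finset.mul_sum, Finset.sum_comm]
        simp [← Finset.mul_sum, sum_Pmat hT hπ]
  have h0 : ∑ s', n s' = 0 := by
    have := Finset.sum_nonneg fun s (_ : s ∈ Finset.univ) => hn s
    nlinarith
  exact (Finset.sum_eq_zero_iff_of_nonneg fun s _ => hn s).1 h0 s (Finset.mem_univ s)

lemma exists_isFlow {T : S → A → S → ℝ} (hT : IsTransModel T)
    {d0 : S → ℝ} (hd0 : IsDist d0) {γ : ℝ} (hγ0 : 0 ≤ γ) (hγ1 : γ < 1)
    {π : S → A → ℝ} (hπ : IsPolicy π) :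
    ∃ ν : S → ℝ, IsFlow T d0 γ π ν ∧ ∀ s, 0 ≤ ν s := by
  classical
  set M := (1 : Matrix S S ℝ) - γ • Pmat T π with hM
  have hflow : IsFlow T d0 γ π (d0 ᵥ* M⁻¹) := by
    intro s'
    have h : (d0 ᵥ* M⁻¹) ᵥ* M = d0 := by
      rw [Matrix.vecMul_vecMul,
        Matrix.nonsing_inv_mul _ (isUnit_det_one_sub_smul_Pmat hT hγ0 hγ1 hπ), Matrix.vecMul_one]
    generalize d0 ᵥ* M⁻¹ = ν at h
    rw [hM, Matrix.vecMul_sub, Matrix.vecMul_one, Matrix.vecMul_smul] at h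
    have := congrFun h s'
    simp only [Pi.sub_apply, Pi.smul_apply, smul_eq_mul, Matrix.vecMul, dotProduct] at this
    linarith
  generalize d0 ᵥ* M⁻¹ = ν at hflow
  refine ⟨ν, hflow, fun s => ?_⟩
  have hneg := eq_zero_of_le_discounted hT hγ1 hπ (n := fun s => max (-ν s) 0)
    (fun s => le_max_right _ _) (fun s' => ?_) s
  · have := le_max_left (-ν s) 0
    linarith
  · refine max_le ?_ (mul_nonneg hγ0 (Finset.sum_nonneg fun s _ =>
      mul_nonneg (le_max_right _ _) (Pmat_nonneg hT hπ s s')))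
    have h : -∑ s, ν s * Pmat T π s s' ≤ ∑ s, max (-ν s) 0 * Pmat T π s s' := by
      rw [← Finset.sum_neg_distrib]
      refine Finset.sum_le_sum fun s _ => ?_
      rw [← neg_mul]
      exact mul_le_mul_of_nonneg_right (le_max_left _ _) (Pmat_nonneg hT hπ s s')
    have := hflow s'
    have := hd0.1 s'
    nlinarith [mul_le_mul_of_nonneg_left h hγ0]

/-- A state not visited by a fully mixed policy is not visited by any policy. -/
lemma flow_eq_zero_of_mem_PiPlus {T : S → A → S → ℝ} (hT : IsTransModel T)
    {d0 : S → ℝ} (hd0 : IsDist d0) {γ : ℝ} (hγ0 : 0 ≤ γ) (hγ1 : γ < 1)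
    {π π' : S → A → ℝ} (hπ : π ∈ PiPlus) (hπ' : IsPolicy π') {μ ν : S → ℝ}
    (hμ : IsFlow T d0 γ π μ) (hμ0 : ∀ s, 0 ≤ μ s)
    (hν : IsFlow T d0 γ π' ν) (hν0 : ∀ s, 0 ≤ ν s) {s : S} (hs : μ s = 0) : ν s = 0 := by
  classical
  have key := eq_zero_of_le_discounted hT hγ1 hπ' (n := fun s => if μ s = 0 then ν s else 0)
    (fun s => by split_ifs <;> simp [hν0]) (fun s' => ?_) s
  · simpa [hs] using key
  · by_cases hs' : μ s' = 0
    · have hflow := hμ s'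
      have hsum : 0 ≤ ∑ s, μ s * Pmat T π s s' :=
        Finset.sum_nonneg fun s _ => mul_nonneg (hμ0 s) (Pmat_nonneg hT hπ.1 s s')
      have hd : d0 s' = 0 := by nlinarith [hd0.1 s', mul_nonneg hγ0 hsum]
      have hγsum : γ * ∑ s, μ s * Pmat T π s s' = 0 := by linarith
      rw [if_pos hs', hν s', hd, zero_add]
      rcases mul_eq_zero.1 hγsum with h | h
      · simp [h]
      refine le_of_eq (congrArg _ (Finset.sum_congr rfl fun s _ => ?_))
      split_ifs with hμs
      · rfl
      have hP : Pmat T π s s' = 0 := by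
        have := (Finset.sum_eq_zero_iff_of_nonneg fun s _ =>
          mul_nonneg (hμ0 s) (Pmat_nonneg hT hπ.1 s s')).1 h s (Finset.mem_univ s)
        exact (mul_eq_zero.1 this).resolve_left hμs
      have hP' : Pmat T π' s s' = 0 := by
        refine Finset.sum_eq_zero fun a ha => ?_
        have := (Finset.sum_eq_zero_iff_of_nonneg fun a _ =>
          mul_nonneg (hπ.2 s a).le ((hT s a).1 s')).1 hP a ha
        rw [(mul_eq_zero.1 this).resolve_left (hπ.2 s a).ne', mul_zero]
      rw [hP', mul_zero, mul_zero]
    · rw [if_neg hs']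
      refine mul_nonneg hγ0 (Finset.sum_nonneg fun s _ => mul_nonneg ?_ (Pmat_nonneg hT hπ' s s'))
      split_ifs <;> simp [hν0]

lemma sum_mul_Pmat (T : S → A → S → ℝ) (π : S → A → ℝ) (ν : S → ℝ) (s' : S) :
    ∑ s, ν s * Pmat T π s s' = ∑ s, ∑ a, ν s * π s a * T s a s' := by
  simp [Pmat, Finset.mul_sum, mul_assoc]

lemma sum_mixture (f g h : S → A → ℝ) (t : ℝ) :
    ∑ s, ∑ a, ((1 - t) * f s a + t * g s a) * h s a
      = (1 - t) * ∑ s, ∑ a, f s a * h s a + t * ∑ s, ∑ a, g s a * h s a := by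
  simp [Finset.mul_sum, add_mul, Finset.sum_add_distrib, mul_assoc]

/-- Arbitrarily close to a fully mixed policy `π` there are fully mixed policies whose values
interpolate linearly between those of `π` and of any other policy `π'`, for all rewards at once. -/
lemma eventually_exists_mixture [DecidableEq S] {T : S → A → S → ℝ} (hT : IsTransModel T)
    {d0 : S → ℝ} (hd0 : IsDist d0) {γ : ℝ} (hγ0 : 0 ≤ γ) (hγ1 : γ < 1)
    {U : Set (S → A → ℝ)} (hU : IsOpen U) {π π' : S → A → ℝ} (hπ : π ∈ U ∩ PiPlus)
    (hπ' : IsPolicy π') :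
    ∀ᶠ t in 𝓝[>] (0 : ℝ), ∃ ρ ∈ U ∩ PiPlus, ∀ R : S → A → ℝ,
      Jval T R d0 γ ρ = (1 - t) * Jval T R d0 γ π + t * Jval T R d0 γ π' := by
  obtain ⟨μ, hμ, hμ0⟩ := exists_isFlow hT hd0 hγ0 hγ1 hπ.2.1
  obtain ⟨ν, hν, hν0⟩ := exists_isFlow hT hd0 hγ0 hγ1 hπ'
  have hsupp : ∀ s, μ s = 0 → ν s = 0 := fun s =>
    flow_eq_zero_of_mem_PiPlus hT hd0 hγ0 hγ1 hπ.2 hπ' hμ hμ0 hν hν0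
  have hnear : ∀ᶠ t in 𝓝 (0 : ℝ), mixPolicy π π' μ ν t ∈ U :=
    (continuousAt_mixPolicy π π' μ ν).eventually_mem
      (hU.mem_nhds (by rw [mixPolicy_zero]; exact hπ.1))
  filter_upwards [hnear.filter_mono nhdsWithin_le_nhds, Ioo_mem_nhdsGT (zero_lt_one' ℝ)]
    with t htU ⟨ht0, ht1⟩
  have hρ := mixPolicy_mem_PiPlus hπ.2 hπ' hμ0 hν0 ht0.le ht1
  refine ⟨_, ⟨htU, hρ⟩, fun R => ?_⟩
  have hmul := mul_mixPolicy (π := π) (π' := π') hμ0 hν0 hsupp ht0.le ht1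
  have hflow : IsFlow T d0 γ (mixPolicy π π' μ ν t) (fun s => (1 - t) * μ s + t * ν s) := by
    intro s'
    have h1 := hμ s'
    have h2 := hν s'
    rw [sum_mul_Pmat] at h1 h2 ⊢
    simp only [hmul]
    rw [sum_mixture (fun s a => μ s * π s a) (fun s a => ν s * π' s a) (fun s a => T s a s')]
    linear_combination (1 - t) * h1 + t * h2
  rw [Jval_eq_of_isFlow hT hγ0 hγ1 hρ.1 hflow, Jval_eq_of_isFlow hT hγ0 hγ1 hπ.2.1 hμ,
    Jval_eq_of_isFlow hT hγ0 hγ1 hπ' hν]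
  simp only [hmul]
  exact sum_mixture (fun s a => μ s * π s a) (fun s a => ν s * π' s a) R t

lemma exists_hacking_of_order_mismatch [DecidableEq S] {T : S → A → S → ℝ} (hT : IsTransModel T)
    {d0 : S → ℝ} (hd0 : IsDist d0) {γ : ℝ} (hγ0 : 0 ≤ γ) (hγ1 : γ < 1) {R R' : S → A → ℝ}
    {U : Set (S → A → ℝ)} (hU : IsOpen U) {π : S → A → ℝ} (hπ : π ∈ U ∩ PiPlus)
    {x y u v : S → A → ℝ} (hx : IsPolicy x) (hy : IsPolicy y) (hu : IsPolicy u) (hv : IsPolicy v)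
    (hle : Jval T R d0 γ y ≤ Jval T R d0 γ x) (hlt' : Jval T R' d0 γ x < Jval T R' d0 γ y)
    (hlt : Jval T R d0 γ v < Jval T R d0 γ u) :
    ∃ p ∈ U ∩ PiPlus, ∃ q ∈ U ∩ PiPlus,
      Jval T R d0 γ q < Jval T R d0 γ p ∧ Jval T R' d0 γ p < Jval T R' d0 γ q := by
  obtain ⟨t, ⟨x₁, hx₁, hJx⟩, ⟨y₁, hy₁, hJy⟩, ht⟩ :=
    ((eventually_exists_mixture hT hd0 hγ0 hγ1 hU hπ hx).and
      ((eventually_exists_mixture hT hd0 hγ0 hγ1 hU hπ hy).and self_mem_nhdsWithin)).exists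
  have ht : 0 < t := ht
  have hle₁ : Jval T R d0 γ y₁ ≤ Jval T R d0 γ x₁ := by rw [hJx, hJy]; gcongr
  have hlt₁ : Jval T R' d0 γ x₁ < Jval T R' d0 γ y₁ := by rw [hJx, hJy]; gcongr
  have hsmall : ∀ᶠ ε in 𝓝[>] (0 : ℝ),
      (1 - ε) * Jval T R' d0 γ x₁ + ε * Jval T R' d0 γ u
        < (1 - ε) * Jval T R' d0 γ y₁ + ε * Jval T R' d0 γ v := by
    refine Filter.Eventually.filter_mono nhdsWithin_le_nhds
      (ContinuousAt.eventually_lt (by fun_prop) (by fun_prop) (by simpa using hlt₁))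
  obtain ⟨ε, ⟨p, hp, hJp⟩, ⟨q, hq, hJq⟩, hε', hε⟩ :=
    ((eventually_exists_mixture hT hd0 hγ0 hγ1 hU hx₁ hu).and
      ((eventually_exists_mixture hT hd0 hγ0 hγ1 hU hy₁ hv).and
        (hsmall.and (Ioo_mem_nhdsGT (zero_lt_one' ℝ))))).exists
  refine ⟨p, hp, q, hq, ?_, by rw [hJp, hJq]; exact hε'⟩
  rw [hJp, hJq]
  nlinarith [mul_le_mul_of_nonneg_left hle₁ (sub_nonneg.2 hε.2.le), mul_lt_mul_of_pos_left hlt hε.1]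

end FlowMixtures

/-- **Reward hacking on open policy sets** (Theorem 1 of Skalse et al.): on any
policy set containing a nonempty subset open in `Π⁺`, every non-trivial,
non-equivalent pair of reward functions is hackable. -/
theorem stmt13 {S A : Type*} [Fintype S] [Fintype A] [DecidableEq S] [Nonempty S]
    (hA : 1 < Fintype.card A)
    (T : S → A → S → ℝ) (hT : IsTransModel T)
    (d0 : S → ℝ) (hd0 : IsDist d0)
    (γ : ℝ) (hγ0 : 0 ≤ γ) (hγ1 : γ < 1)
    (R R' : S → A → ℝ)
    (Ps : Set (S → A → ℝ)) (hPs : ∀ p ∈ Ps, IsPolicy p)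
    -- `Ps` contains a nonempty subset open in `Π⁺`
    (hopen : ∃ Pt : Set (S → A → ℝ), Pt ⊆ Ps ∧ Pt.Nonempty ∧
      ∃ U : Set (S → A → ℝ), IsOpen U ∧ Pt = U ∩ PiPlus)
    -- `J_R` is non-constant on `Ps`
    (hnc : ∃ π ∈ Ps, ∃ π' ∈ Ps, Jval T R d0 γ π ≠ Jval T R d0 γ π')
    -- `J_{R'}` is non-constant on `Ps`
    (hnc' : ∃ π ∈ Ps, ∃ π' ∈ Ps, Jval T R' d0 γ π ≠ Jval T R' d0 γ π')
    -- `J_R` and `J_{R'}` do not induce the same ordering on `Ps`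
    (hneq : ¬ ∀ π ∈ Ps, ∀ π' ∈ Ps,
      (Jval T R d0 γ π' ≤ Jval T R d0 γ π ↔
        Jval T R' d0 γ π' ≤ Jval T R' d0 γ π)) :
    ∃ π ∈ Ps, ∃ π' ∈ Ps,
      Jval T R d0 γ π' < Jval T R d0 γ π ∧
      Jval T R' d0 γ π < Jval T R' d0 γ π' := by
  obtain ⟨_, hsub, ⟨π₀, hπ₀⟩, U, hU, rfl⟩ := hopen
  have ordered : ∀ Q : S → A → ℝ, (∃ π ∈ Ps, ∃ π' ∈ Ps, Jval T Q d0 γ π ≠ Jval T Q d0 γ π') →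
      ∃ u ∈ Ps, ∃ v ∈ Ps, Jval T Q d0 γ v < Jval T Q d0 γ u := by
    rintro Q ⟨u, hu, v, hv, h⟩
    rcases lt_or_gt_of_ne h with h | h
    exacts [⟨v, hv, u, hu, h⟩, ⟨u, hu, v, hv, h⟩]
  obtain ⟨u, hu, v, hv, huv⟩ := ordered R hnc
  obtain ⟨u', hu', v', hv', huv'⟩ := ordered R' hnc'
  push Not at hneq
  obtain ⟨x, hx, y, hy, ⟨hle, hlt⟩ | ⟨hlt, hle⟩⟩ := hneq
  · obtain ⟨p, hp, q, hq, h, h'⟩ := exists_hacking_of_order_mismatch hT hd0 hγ0 hγ1 hU hπ₀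
      (hPs x hx) (hPs y hy) (hPs u hu) (hPs v hv) hle hlt huv
    exact ⟨p, hsub hp, q, hsub hq, h, h'⟩
  · obtain ⟨p, hp, q, hq, h, h'⟩ := exists_hacking_of_order_mismatch hT hd0 hγ0 hγ1 hU hπ₀
      (hPs x hx) (hPs y hy) (hPs u' hu') (hPs v' hv') hle hlt huv'
    exact ⟨q, hsub hq, p, hsub hp, h', h⟩
end

section
/- Square-root heuristic: fix a finite task (S, A, d0, R, γ) with R : S × A → [0,1] and γ ∈ [0,1), and distinct transition models T, T' with total variation distance δ = (1/2) max_{s,a} ‖T(·|s,a) − T'(·|s,a)‖_1 > 0. For any ε > 0, if 1/(1−γ) < √(ε/δ), then (T, T') is ε-unexploitable on every set of stationary policies: there exist no π, π' with J_T(π) − J_T(π') > ε and J_{T'}(π') − J_{T'}(π) > ε. -/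
open Matrix

/-- The value vector `V^π = (I - γ P^π)⁻¹ r^π`. -/
noncomputable def valueVec {S A : Type*} [Fintype S] [Fintype A] [DecidableEq S]
    (T : S → A → S → ℝ) (R : S → A → ℝ) (γ : ℝ) (π : S → A → ℝ) : S → ℝ :=
  ((1 : Matrix S S ℝ) - γ • Pmat T π)⁻¹ *ᵥ rvec R π

/-- The expectation of a function bounded by `c` is bounded by `c`. -/
lemma IsDist.sum_mul_le {S : Type*} [Fintype S] {p : S → ℝ} (hp : IsDist p)
    {x : S → ℝ} {c : ℝ} (h : ∀ s, x s ≤ c) : ∑ s, p s * x s ≤ c :=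
  calc ∑ s, p s * x s ≤ ∑ s, p s * c :=
        Finset.sum_le_sum fun s _ => mul_le_mul_of_nonneg_left (h s) (hp.1 s)
    _ = c := by rw [← Finset.sum_mul, hp.2, one_mul]

lemma isDist_Pmat {S A : Type*} [Fintype S] [Fintype A] {T : S → A → S → ℝ}
    (hT : IsTransModel T) {π : S → A → ℝ} (hπ : IsPolicy π) (s : S) :
    IsDist (Pmat T π s) := by
  refine ⟨fun s' => Finset.sum_nonneg fun a _ => mul_nonneg ((hπ s).1 a) ((hT s a).1 s'), ?_⟩
  simp only [Pmat, Matrix.of_apply]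
  rw [Finset.sum_comm]
  simp_rw [← Finset.mul_sum, (hT s _).2, mul_one]
  exact (hπ s).2

/-- Maximum principle for discounted stochastic matrices. -/
lemma le_div_of_le_discounted_add {S : Type*} [Fintype S] {P : Matrix S S ℝ}
    (hP : ∀ s, IsDist (P s)) {γ : ℝ} (hγ0 : 0 ≤ γ) (hγ1 : γ < 1) {x : S → ℝ} {c : ℝ}
    (h : ∀ s, x s ≤ γ * (P *ᵥ x) s + c) (s : S) : x s ≤ c / (1 - γ) := by
  have : Nonempty S := ⟨s⟩
  obtain ⟨m, hm⟩ := Finite.exists_max x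
  have havg : (P *ᵥ x) m ≤ x m := (hP m).sum_mul_le hm
  refine (hm s).trans ?_
  rw [le_div_iff₀ (by linarith)]
  nlinarith [h m, mul_le_mul_of_nonneg_left havg hγ0]

lemma abs_le_div_of_eq_discounted_add {S : Type*} [Fintype S] {P : Matrix S S ℝ}
    (hP : ∀ s, IsDist (P s)) {γ : ℝ} (hγ0 : 0 ≤ γ) (hγ1 : γ < 1) {x b : S → ℝ} {c : ℝ}
    (h : ∀ s, x s = γ * (P *ᵥ x) s + b s) (hb : ∀ s, |b s| ≤ c) (s : S) :
    |x s| ≤ c / (1 - γ) := by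
  refine abs_le'.2 ⟨le_div_of_le_discounted_add hP hγ0 hγ1 (fun t => ?_) s,
    le_div_of_le_discounted_add hP hγ0 hγ1 (x := -x) (fun t => ?_) s⟩
  · linarith [h t, (abs_le.1 (hb t)).2]
  · rw [Matrix.mulVec_neg, Pi.neg_apply, Pi.neg_apply]
    linarith [h t, (abs_le.1 (hb t)).1]

lemma isUnit_one_sub_discounted {S : Type*} [Fintype S] [DecidableEq S] {P : Matrix S S ℝ}
    (hP : ∀ s, IsDist (P s)) {γ : ℝ} (hγ0 : 0 ≤ γ) (hγ1 : γ < 1) :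
    IsUnit (1 - γ • P) := by
  rw [← Matrix.mulVec_injective_iff_isUnit]
  refine (injective_iff_map_eq_zero (1 - γ • P).mulVecLin).2 fun x hx => ?_
  funext s
  have hfix : ∀ t, x t = γ * (P *ᵥ x) t + 0 := fun t => by
    have := congrFun hx t
    simp only [Matrix.mulVecLin_apply, Matrix.sub_mulVec, Matrix.one_mulVec, Matrix.smul_mulVec,
      Pi.sub_apply, Pi.smul_apply, smul_eq_mul, Pi.zero_apply] at this
    linarith
  have := abs_le_div_of_eq_discounted_add hP hγ0 hγ1 (b := fun _ => 0) (c := 0) hfix (by simp) s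
  rw [zero_div] at this
  exact abs_nonpos_iff.1 this

/-- The Bellman equation for a stationary policy. -/
lemma valueVec_bellman {S A : Type*} [Fintype S] [Fintype A] [DecidableEq S]
    {T : S → A → S → ℝ} (hT : IsTransModel T) (R : S → A → ℝ) {γ : ℝ}
    (hγ0 : 0 ≤ γ) (hγ1 : γ < 1) {π : S → A → ℝ} (hπ : IsPolicy π) (s : S) :
    valueVec T R γ π s = γ * (Pmat T π *ᵥ valueVec T R γ π) s + rvec R π s := by
  have hu := isUnit_one_sub_discounted (isDist_Pmat hT hπ) hγ0 hγ1
  have h : (1 - γ • Pmat T π) *ᵥ valueVec T R γ π = rvec R π := by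
    rw [valueVec, Matrix.mulVec_mulVec,
      Matrix.mul_nonsing_inv _ ((Matrix.isUnit_iff_isUnit_det _).1 hu), Matrix.one_mulVec]
  have := congrFun h s
  simp only [Matrix.sub_mulVec, Matrix.one_mulVec, Matrix.smul_mulVec,
    Pi.sub_apply, Pi.smul_apply, smul_eq_mul] at this
  linarith

lemma valueVec_mem_Icc {S A : Type*} [Fintype S] [Fintype A] [DecidableEq S]
    {T : S → A → S → ℝ} (hT : IsTransModel T) {R : S → A → ℝ}
    (hR : ∀ s a, R s a ∈ Set.Icc (0 : ℝ) 1) {γ : ℝ}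
    (hγ0 : 0 ≤ γ) (hγ1 : γ < 1) {π : S → A → ℝ} (hπ : IsPolicy π) (s : S) :
    valueVec T R γ π s ∈ Set.Icc 0 (1 / (1 - γ)) := by
  have hP := isDist_Pmat hT hπ
  have hV := valueVec_bellman hT R hγ0 hγ1 hπ
  constructor
  · have := le_div_of_le_discounted_add hP hγ0 hγ1 (x := -valueVec T R γ π) (c := 0)
      (fun t => by
        have hr : 0 ≤ rvec R π t :=
          Finset.sum_nonneg fun a _ => mul_nonneg ((hπ t).1 a) (hR t a).1
        rw [Matrix.mulVec_neg, Pi.neg_apply, Pi.neg_apply]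
        linarith [hV t]) s
    rw [zero_div, Pi.neg_apply] at this
    linarith
  · refine le_div_of_le_discounted_add hP hγ0 hγ1 (fun t => ?_) s
    have hr : rvec R π t ≤ 1 := IsDist.sum_mul_le (hπ t) fun a => (hR t a).2
    linarith [hV t]

/-- Two distributions at `ℓ¹` distance at most `2 δ` have expectations of a `[0, M]`-valued
function differing by at most `δ * M`. -/
lemma abs_sum_sub_mul_le {S : Type*} [Fintype S] {p q : S → ℝ} (hp : IsDist p) (hq : IsDist q)
    {δ M : ℝ} (hδ : ∑ s, |p s - q s| ≤ 2 * δ) {x : S → ℝ} (hM : 0 ≤ M)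
    (hx : ∀ s, x s ∈ Set.Icc 0 M) : |∑ s, (p s - q s) * x s| ≤ δ * M := by
  have hcenter : ∑ s, (p s - q s) * x s = ∑ s, (p s - q s) * (x s - M / 2) := by
    simp_rw [mul_sub _ (x _)]
    rw [Finset.sum_sub_distrib, ← Finset.sum_mul, Finset.sum_sub_distrib, hp.2, hq.2]
    ring
  rw [hcenter]
  calc |∑ s, (p s - q s) * (x s - M / 2)|
      ≤ ∑ s, |p s - q s| * (M / 2) := by
        refine (Finset.abs_sum_le_sum_abs _ _).trans (Finset.sum_le_sum fun s _ => ?_)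
        rw [abs_mul]
        refine mul_le_mul_of_nonneg_left (abs_le.2 ⟨?_, ?_⟩) (abs_nonneg _)
        · linarith [(hx s).1]
        · linarith [(hx s).2]
    _ ≤ 2 * δ * (M / 2) := by
        rw [← Finset.sum_mul]
        exact mul_le_mul_of_nonneg_right hδ (by linarith)
    _ = δ * M := by ring

lemma abs_Pmat_sub_mulVec_le {S A : Type*} [Fintype S] [Fintype A] {T T' : S → A → S → ℝ}
    (hT : IsTransModel T) (hT' : IsTransModel T') {δ M : ℝ}
    (hδ : ∀ s a, ∑ s', |T s a s' - T' s a s'| ≤ 2 * δ) {π : S → A → ℝ} (hπ : IsPolicy π)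
    {x : S → ℝ} (hM : 0 ≤ M) (hx : ∀ s, x s ∈ Set.Icc 0 M) (s : S) :
    |(Pmat T π *ᵥ x) s - (Pmat T' π *ᵥ x) s| ≤ δ * M := by
  have hexpand : (Pmat T π *ᵥ x) s - (Pmat T' π *ᵥ x) s
      = ∑ a, π s a * ∑ s', (T s a s' - T' s a s') * x s' := by
    simp only [Matrix.mulVec, dotProduct, Pmat, Matrix.of_apply]
    rw [← Finset.sum_sub_distrib]
    simp_rw [Finset.mul_sum, ← sub_mul, ← Finset.sum_sub_distrib, Finset.sum_mul]
    rw [Finset.sum_comm]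
    exact Finset.sum_congr rfl fun a _ => Finset.sum_congr rfl fun s' _ => by ring
  rw [hexpand]
  refine (Finset.abs_sum_le_sum_abs _ _).trans ?_
  simp_rw [abs_mul, abs_of_nonneg ((hπ s).1 _)]
  exact IsDist.sum_mul_le (hπ s) fun a => abs_sum_sub_mul_le (hT s a) (hT' s a) (hδ s a) hM hx

/-- Simulation lemma: the policy value is Lipschitz in the transition model. -/
lemma abs_Jval_sub_le {S A : Type*} [Fintype S] [Fintype A] [DecidableEq S]
    {d0 : S → ℝ} (hd0 : IsDist d0) {R : S → A → ℝ} (hR : ∀ s a, R s a ∈ Set.Icc (0 : ℝ) 1)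
    {γ : ℝ} (hγ0 : 0 ≤ γ) (hγ1 : γ < 1) {T T' : S → A → S → ℝ}
    (hT : IsTransModel T) (hT' : IsTransModel T') {δ : ℝ}
    (hδ : ∀ s a, ∑ s', |T s a s' - T' s a s'| ≤ 2 * δ) {π : S → A → ℝ} (hπ : IsPolicy π) :
    |Jval T R d0 γ π - Jval T' R d0 γ π| ≤ γ * (δ * (1 / (1 - γ))) / (1 - γ) := by
  have hM : 0 ≤ 1 / (1 - γ) := one_div_nonneg.2 (by linarith)
  have hdiff : ∀ s, |valueVec T R γ π s - valueVec T' R γ π s|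
      ≤ γ * (δ * (1 / (1 - γ))) / (1 - γ) := by
    refine abs_le_div_of_eq_discounted_add (isDist_Pmat hT hπ) hγ0 hγ1
      (x := valueVec T R γ π - valueVec T' R γ π)
      (b := fun s => γ * ((Pmat T π *ᵥ valueVec T' R γ π) s
        - (Pmat T' π *ᵥ valueVec T' R γ π) s)) (fun s => ?_) (fun s => ?_)
    · rw [Matrix.mulVec_sub, Pi.sub_apply, Pi.sub_apply, valueVec_bellman hT R hγ0 hγ1 hπ s,
        valueVec_bellman hT' R hγ0 hγ1 hπ s]
      ring
    · rw [abs_mul, abs_of_nonneg hγ0]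
      exact mul_le_mul_of_nonneg_left (abs_Pmat_sub_mulVec_le hT hT' hδ hπ hM
        (valueVec_mem_Icc hT' hR hγ0 hγ1 hπ) s) hγ0
  have hJ : Jval T R d0 γ π - Jval T' R d0 γ π
      = ∑ s, d0 s * (valueVec T R γ π s - valueVec T' R γ π s) := by
    simp_rw [mul_sub]
    rw [Finset.sum_sub_distrib]
    rfl
  rw [hJ]
  refine (Finset.abs_sum_le_sum_abs _ _).trans ?_
  simp_rw [abs_mul, abs_of_nonneg (hd0.1 _)]
  exact hd0.sum_mul_le hdiff

/-- **Square-root heuristic**: if `1/(1-γ) < √(ε/δ)`, where `δ` is the total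
variation distance between the distinct transition models `T` and `T'`, then
`(T, T')` is ε-unexploitable on every set of stationary policies. -/
theorem stmt16 {S A : Type*} [Fintype S] [Fintype A] [DecidableEq S]
    [Nonempty S] [Nonempty A]
    (hA : 1 < Fintype.card A)
    (d0 : S → ℝ) (hd0 : IsDist d0)
    (R : S → A → ℝ) (hR : ∀ s a, R s a ∈ Set.Icc (0 : ℝ) 1)
    (γ : ℝ) (hγ0 : 0 ≤ γ) (hγ1 : γ < 1)
    (T T' : S → A → S → ℝ) (hT : IsTransModel T) (hT' : IsTransModel T')
    (hTT' : T ≠ T')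
    (δ : ℝ)
    -- `δ` is the total variation distance between `T` and `T'`
    (hδdef : δ = (1 / 2) * ⨆ p : S × A, ∑ s', |T p.1 p.2 s' - T' p.1 p.2 s'|)
    (hδpos : 0 < δ)
    (ε : ℝ) (hε : 0 < ε)
    (hH : 1 / (1 - γ) < Real.sqrt (ε / δ)) :
    ∀ Ps : Set (S → A → ℝ), (∀ p ∈ Ps, IsPolicy p) →
      ¬ ∃ π ∈ Ps, ∃ π' ∈ Ps,
        ε < Jval T R d0 γ π - Jval T R d0 γ π' ∧
        ε < Jval T' R d0 γ π' - Jval T' R d0 γ π := by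
  rintro Ps hPs ⟨π, hπ, π', hπ', hlt, hlt'⟩
  have hδ : ∀ s a, ∑ s', |T s a s' - T' s a s'| ≤ 2 * δ := fun s a => by
    have := le_ciSup (f := fun p : S × A => ∑ s', |T p.1 p.2 s' - T' p.1 p.2 s'|)
      (Set.finite_range _).bddAbove (s, a)
    rw [hδdef]
    linarith
  have hpos : 0 < 1 - γ := by linarith
  have hbound : γ * (δ * (1 / (1 - γ))) / (1 - γ) ≤ ε := by
    have hsq : (1 / (1 - γ)) ^ 2 < ε / δ := (Real.lt_sqrt (by positivity)).1 hH
    rw [lt_div_iff₀ hδpos] at hsq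
    have hrw : γ * (δ * (1 / (1 - γ))) / (1 - γ) = γ * ((1 / (1 - γ)) ^ 2 * δ) := by
      field_simp
    rw [hrw]
    exact (mul_le_of_le_one_left (by positivity) hγ1.le).trans hsq.le
  have h := (abs_le.1 (abs_Jval_sub_le hd0 hR hγ0 hγ1 hT hT' hδ (hPs π hπ))).2
  have h' := (abs_le.1 (abs_Jval_sub_le hd0 hR hγ0 hγ1 hT hT' hδ (hPs π' hπ'))).1
  linarith
end
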